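/- The complete graph K_5 has no 2-simultaneous edge coloring. -/

import Mathlib

open SimpleGraph

/-- A proper edge coloring of `G`: incident distinct edges receive different colors. -/
def IsProperEdgeColoring {V : Type*} (G : SimpleGraph V) (c : Sym2 V → ℕ) : Prop :=
  ∀ e₁ ∈ G.edgeSet, ∀ e₂ ∈ G.edgeSet, e₁ ≠ e₂ → (∃ v, v ∈ e₁ ∧ v ∈ e₂) → c e₁ ≠ c e₂

/-- The set of colors appearing on the edges of `G` incident to the vertex `v`. -/
def colorsAt {V : Type*} (G : SimpleGraph V) (c : Sym2 V → ℕ) (v : V) : Set ℕ :=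
  {k | ∃ e ∈ G.edgeSet, v ∈ e ∧ c e = k}

/-- A `μ`-simultaneous edge coloring of `G`: `μ` proper edge colorings such that at every
vertex the set of colors appearing on its incident edges is the same in all colorings, and
no edge gets the same color in two different colorings. -/
def IsSimultaneousEdgeColoring {V : Type*} (G : SimpleGraph V) (μ : ℕ)
    (c : Fin μ → Sym2 V → ℕ) : Prop :=
  (∀ i, IsProperEdgeColoring G (c i)) ∧
  (∀ i j : Fin μ, ∀ v : V, colorsAt G (c i) v = colorsAt G (c j) v) ∧
  (∀ i j : Fin μ, i ≠ j → ∀ e ∈ G.edgeSet, c i e ≠ c j e)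

/-- `G` admits a `μ`-simultaneous edge coloring. -/
def SimultaneousEdgeColorable {V : Type*} (G : SimpleGraph V) (μ : ℕ) : Prop :=
  ∃ c : Fin μ → Sym2 V → ℕ, IsSimultaneousEdgeColoring G μ c

/-- Two edge colorings of a complete graph, viewed as functions of the two endpoints, that are
proper, see the same colors at every vertex and differ on every edge. -/
structure IsTradePair {V : Type*} (A B : V → V → ℕ) : Prop where
  symm_left : ∀ u v, A u v = A v u
  symm_right : ∀ u v, B u v = B v u
  proper_left : ∀ u v w, u ≠ v → u ≠ w → v ≠ w → A u v ≠ A u w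
  proper_right : ∀ u v w, u ≠ v → u ≠ w → v ≠ w → B u v ≠ B u w
  exists_right : ∀ u v, u ≠ v → ∃ w, u ≠ w ∧ B u w = A u v
  exists_left : ∀ u v, u ≠ v → ∃ w, u ≠ w ∧ A u w = B u v
  ne : ∀ u v, u ≠ v → A u v ≠ B u v

lemma IsProperEdgeColoring.ne_of_completeGraph {V : Type*} {c : Sym2 V → ℕ}
    (hc : IsProperEdgeColoring (completeGraph V) c) {u v w : V}
    (huv : u ≠ v) (huw : u ≠ w) (hvw : v ≠ w) : c s(u, v) ≠ c s(u, w) :=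
  hc _ (by simpa using huv) _ (by simpa using huw) (by simp [hvw, huv.symm])
    ⟨u, by simp, by simp⟩

lemma mem_colorsAt_completeGraph {V : Type*} {c : Sym2 V → ℕ} {u : V} {k : ℕ} :
    k ∈ colorsAt (completeGraph V) c u ↔ ∃ w, u ≠ w ∧ c s(u, w) = k := by
  constructor
  · rintro ⟨e, he, hu, rfl⟩
    obtain ⟨w, rfl⟩ := hu
    exact ⟨w, by simpa using he, rfl⟩
  · rintro ⟨w, hw, rfl⟩
    exact ⟨_, by simpa using hw, by simp, rfl⟩

lemma IsSimultaneousEdgeColoring.isTradePair {V : Type*} {c : Fin 2 → Sym2 V → ℕ}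
    (hc : IsSimultaneousEdgeColoring (completeGraph V) 2 c) :
    IsTradePair (fun u v => c 0 s(u, v)) (fun u v => c 1 s(u, v)) := by
  obtain ⟨hp, hs, hd⟩ := hc
  have exists_of (i j : Fin 2) (u v : V) (huv : u ≠ v) :
      ∃ w, u ≠ w ∧ c j s(u, w) = c i s(u, v) := by
    rw [← mem_colorsAt_completeGraph, hs j i, mem_colorsAt_completeGraph]
    exact ⟨v, huv, rfl⟩
  exact
    { symm_left := fun u v => by simp only [Sym2.eq_swap]
      symm_right := fun u v => by simp only [Sym2.eq_swap]
      proper_left := fun _ _ _ => (hp 0).ne_of_completeGraph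
      proper_right := fun _ _ _ => (hp 1).ne_of_completeGraph
      exists_right := exists_of 0 1
      exists_left := exists_of 1 0
      ne := fun u v huv => hd 0 1 (by decide) _ (by simpa using huv) }

section FiveVertices

variable {V : Type*} {A B : V → V → ℕ} {v p q r s : V}

/-- The color of an edge avoiding `v` appears at `v` or on the opposite edge avoiding `v`. -/
lemma IsTradePair.eq_or_eq_or_eq (h : IsTradePair A B) (hV : [v, p, q, r, s].Nodup)
    (cover : ∀ x, x = v ∨ x = p ∨ x = q ∨ x = r ∨ x = s) :
    A p q = A r s ∨ A p q = A v r ∨ A p q = A v s := by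
  obtain ⟨h1, h2, h3, h4, h5, h6, h7⟩ := h
  simp only [List.nodup_cons, List.mem_cons, List.not_mem_nil, not_or, or_false] at hV
  obtain ⟨z, hz, hzB⟩ := h5 p q (by grind)
  obtain ⟨t, ht, htA⟩ := h6 z p (by grind)
  have hzq : z ≠ q := by grind
  have htp : t ≠ p := by grind
  have htq : t ≠ q := by grind
  have := cover z
  have := cover t
  grind

/-- Some color avoids `v` in the first coloring. -/
lemma IsTradePair.exists_opposite (h : IsTradePair A B) (hV : [v, p, q, r, s].Nodup)
    (cover : ∀ x, x = v ∨ x = p ∨ x = q ∨ x = r ∨ x = s) :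
    A p q = A r s ∨ A p r = A q s ∨ A p s = A q r := by
  have hpq := h.eq_or_eq_or_eq hV cover
  have hpr := h.eq_or_eq_or_eq (v := v) (p := p) (q := r) (r := q) (s := s)
    (by grind) (fun x => by grind [cover x])
  have hps := h.eq_or_eq_or_eq (v := v) (p := p) (q := s) (r := q) (s := r)
    (by grind) (fun x => by grind [cover x])
  have hqr := h.eq_or_eq_or_eq (v := v) (p := q) (q := r) (r := p) (s := s)
    (by grind) (fun x => by grind [cover x])
  have hqs := h.eq_or_eq_or_eq (v := v) (p := q) (q := s) (r := p) (s := r)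
    (by grind) (fun x => by grind [cover x])
  have hrs := h.eq_or_eq_or_eq (v := v) (p := r) (q := s) (r := p) (s := q)
    (by grind) (fun x => by grind [cover x])
  obtain ⟨h1, -, h3, -, -, -, -⟩ := h
  simp only [List.nodup_cons, List.mem_cons, List.not_mem_nil, not_or, or_false] at hV
  grind

/-- If a color avoids `v` in the first coloring, then it forms another perfect matching of the
other vertices in the second coloring. -/
lemma IsTradePair.opposite_right (h : IsTradePair A B) (hV : [v, p, q, r, s].Nodup)
    (cover : ∀ x, x = v ∨ x = p ∨ x = q ∨ x = r ∨ x = s) (heq : A p q = A r s) :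
    B p r = B q s ∨ B p s = B q r := by
  obtain ⟨h1, h2, h3, h4, h5, h6, h7⟩ := h
  simp only [List.nodup_cons, List.mem_cons, List.not_mem_nil, not_or, or_false] at hV
  have hv : ∀ w, v ≠ w → B v w ≠ A p q := by
    intro w hw hB
    obtain ⟨t, ht, htA⟩ := h6 v w hw
    have := cover t
    grind
  obtain ⟨z, hz, hzB⟩ := h5 p q (by grind)
  obtain ⟨t, ht, htB⟩ := h5 q p (by grind)
  have hzv : z ≠ v := by grind
  have htv : t ≠ v := by grind
  have hzq : z ≠ q := by grind
  have htp : t ≠ p := by grind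
  have := cover z
  have := cover t
  grind

end FiveVertices

/-- The `i`-th of the three perfect matchings of `Fin 5` with `v` removed. -/
def nearMatching (v : Fin 5) : Fin 3 → Finset (Sym2 (Fin 5))
  | 0 => {s(v + 1, v + 2), s(v + 3, v + 4)}
  | 1 => {s(v + 1, v + 3), s(v + 2, v + 4)}
  | 2 => {s(v + 1, v + 4), s(v + 2, v + 3)}

lemma IsProperEdgeColoring.disjoint_nearMatching {c : Sym2 (Fin 5) → ℕ}
    (hc : IsProperEdgeColoring (completeGraph (Fin 5)) c) {v w : Fin 5} (hvw : v ≠ w) {i j : Fin 3}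
    (hv : ∀ e ∈ nearMatching v i, ∀ f ∈ nearMatching v i, c e = c f)
    (hw : ∀ e ∈ nearMatching w j, ∀ f ∈ nearMatching w j, c e = c f) :
    Disjoint (nearMatching v i) (nearMatching w j) := by
  have key : ∀ v w : Fin 5, v ≠ w → ∀ i j, ¬ Disjoint (nearMatching v i) (nearMatching w j) →
      ∃ e ∈ nearMatching v i, ∃ f ∈ nearMatching w j,
        ¬ e.IsDiag ∧ ¬ f.IsDiag ∧ e ≠ f ∧ ∃ u, u ∈ e ∧ u ∈ f := by decide
  by_contra hd
  obtain ⟨e, he, f, hf, hed, hfd, hef, hu⟩ := key v w hvw i j hd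
  obtain ⟨g, hgv, hgw⟩ := Finset.not_disjoint_iff.mp hd
  exact hc e (by simpa using hed) f (by simpa using hfd) hef hu
    ((hv e he g hgv).trans (hw g hgw f hf))

lemma IsTradePair.exists_nearMatching {a b : Sym2 (Fin 5) → ℕ}
    (h : IsTradePair (fun u v => a s(u, v)) (fun u v => b s(u, v))) (v : Fin 5) :
    ∃ i j, i ≠ j ∧ (∀ e ∈ nearMatching v i, ∀ f ∈ nearMatching v i, a e = a f) ∧
      (∀ e ∈ nearMatching v j, ∀ f ∈ nearMatching v j, b e = b f) := by
  have hV : [v, v + 1, v + 2, v + 3, v + 4].Nodup := by revert v; decide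
  have cover : ∀ x, x = v ∨ x = v + 1 ∨ x = v + 2 ∨ x = v + 3 ∨ x = v + 4 := by
    revert v; decide
  rcases h.exists_opposite hV cover with h0 | h0 | h0
  · rcases h.opposite_right hV cover h0 with h1 | h1
    · exact ⟨0, 1, by decide, by simp_all [nearMatching], by simp_all [nearMatching]⟩
    · exact ⟨0, 2, by decide, by simp_all [nearMatching], by simp_all [nearMatching]⟩
  · have hV' : [v, v + 1, v + 3, v + 2, v + 4].Nodup := by clear h0 cover hV; revert v; decide
    rcases h.opposite_right (v := v) hV' (fun x => by grind [cover x]) h0 with h1 | h1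
    · exact ⟨1, 0, by decide, by simp_all [nearMatching], by simp_all [nearMatching]⟩
    · exact ⟨1, 2, by decide, by simp_all [nearMatching],
        by simp_all [nearMatching, Sym2.eq_swap]⟩
  · have hV' : [v, v + 1, v + 4, v + 2, v + 3].Nodup := by clear h0 cover hV; revert v; decide
    rcases h.opposite_right (v := v) hV' (fun x => by grind [cover x]) h0 with h1 | h1
    · exact ⟨2, 0, by decide, by simp_all [nearMatching], by simp_all [nearMatching, Sym2.eq_swap]⟩
    · exact ⟨2, 1, by decide, by simp_all [nearMatching], by simp_all [nearMatching, Sym2.eq_swap]⟩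

set_option synthInstance.maxSize 1000 in
set_option synthInstance.maxHeartbeats 200000 in
set_option maxRecDepth 10000 in
/-- Any two near-one-factorizations of `K₅` agree at some vertex. -/
lemma exists_eq_of_disjoint_nearMatching (x y : Fin 5 → Fin 3)
    (hx : ∀ v w, v ≠ w → Disjoint (nearMatching v (x v)) (nearMatching w (x w)))
    (hy : ∀ v w, v ≠ w → Disjoint (nearMatching v (y v)) (nearMatching w (y w))) :
    ∃ v, x v = y v := by
  have key :
      ∀ x₀,
      ∀ x₁,
        Disjoint (nearMatching 0 x₀) (nearMatching 1 x₁) →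
      ∀ x₂,
        Disjoint (nearMatching 0 x₀) (nearMatching 2 x₂) →
        Disjoint (nearMatching 1 x₁) (nearMatching 2 x₂) →
      ∀ x₃,
        Disjoint (nearMatching 0 x₀) (nearMatching 3 x₃) →
        Disjoint (nearMatching 1 x₁) (nearMatching 3 x₃) →
        Disjoint (nearMatching 2 x₂) (nearMatching 3 x₃) →
      ∀ x₄,
        Disjoint (nearMatching 0 x₀) (nearMatching 4 x₄) →
        Disjoint (nearMatching 1 x₁) (nearMatching 4 x₄) →
        Disjoint (nearMatching 2 x₂) (nearMatching 4 x₄) →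
        Disjoint (nearMatching 3 x₃) (nearMatching 4 x₄) →
      ∀ y₀, x₀ ≠ y₀ →
      ∀ y₁, x₁ ≠ y₁ →
        Disjoint (nearMatching 0 y₀) (nearMatching 1 y₁) →
      ∀ y₂, x₂ ≠ y₂ →
        Disjoint (nearMatching 0 y₀) (nearMatching 2 y₂) →
        Disjoint (nearMatching 1 y₁) (nearMatching 2 y₂) →
      ∀ y₃, x₃ ≠ y₃ →
        Disjoint (nearMatching 0 y₀) (nearMatching 3 y₃) →
        Disjoint (nearMatching 1 y₁) (nearMatching 3 y₃) →
        Disjoint (nearMatching 2 y₂) (nearMatching 3 y₃) →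
      ∀ y₄, x₄ ≠ y₄ →
        Disjoint (nearMatching 0 y₀) (nearMatching 4 y₄) →
        Disjoint (nearMatching 1 y₁) (nearMatching 4 y₄) →
        Disjoint (nearMatching 2 y₂) (nearMatching 4 y₄) →
        Disjoint (nearMatching 3 y₃) (nearMatching 4 y₄) →
      False := by decide
  by_contra! hne
  exact key
    _
    _ (hx 0 1 (by decide))
    _ (hx 0 2 (by decide)) (hx 1 2 (by decide))
    _ (hx 0 3 (by decide)) (hx 1 3 (by decide)) (hx 2 3 (by decide))
    _ (hx 0 4 (by decide)) (hx 1 4 (by decide)) (hx 2 4 (by decide)) (hx 3 4 (by decide))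
    _ (hne 0)
    _ (hne 1) (hy 0 1 (by decide))
    _ (hne 2) (hy 0 2 (by decide)) (hy 1 2 (by decide))
    _ (hne 3) (hy 0 3 (by decide)) (hy 1 3 (by decide)) (hy 2 3 (by decide))
    _ (hne 4) (hy 0 4 (by decide)) (hy 1 4 (by decide)) (hy 2 4 (by decide)) (hy 3 4 (by decide))

/-- The complete graph `K₅` has no `2`-simultaneous edge coloring. -/
theorem completeGraph_five_not_simultaneousEdgeColorable :
    ¬ SimultaneousEdgeColorable (completeGraph (Fin 5)) 2 := by
  rintro ⟨c, hc⟩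
  have hp := hc.1
  choose x y hxy hx hy using hc.isTradePair.exists_nearMatching
  obtain ⟨v, hv⟩ := exists_eq_of_disjoint_nearMatching x y
    (fun v w hvw => (hp 0).disjoint_nearMatching hvw (hx v) (hx w))
    (fun v w hvw => (hp 1).disjoint_nearMatching hvw (hy v) (hy w))
  exact hxy v hv
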